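/- arXiv:math/0606200 — 2 statements merged into one kernel-verified Lean document; each statement's English description precedes it below -/
import Mathlib

section
/- Property (P2) of the weight: t^{−α} ω_t^{−2} V_t² = 1 + o(t^{α−1}) as t → ∞; that is, t^{1−α} ( t^{−α} ω_t^{−2} ∫_0^t ω_s² ds − 1 ) → 0 as t → ∞. -/
open MeasureTheory ProbabilityTheory Filter Real Asymptotics

noncomputable section

/-- The weight `ω_s = s^(-α/2) exp(s^(1-α) / (2(1-α)))`. -/
def wgt (α s : ℝ) : ℝ := s ^ (-α / 2) * Real.exp (s ^ (1 - α) / (2 * (1 - α)))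

/-- The derivative of the weight: `ω'_s = ω_s (s^(-α)/2 - α/(2s))`. -/
def wgt' (α s : ℝ) : ℝ := wgt α s * (s ^ (-α) / 2 - α / (2 * s))

/-- `U_t = ∫₀ᵗ ω_s ds`. -/
def Uw (α t : ℝ) : ℝ := ∫ s in (0:ℝ)..t, wgt α s

/-- `V_t² = ∫₀ᵗ ω_s² ds`. -/
def Vsq (α t : ℝ) : ℝ := ∫ s in (0:ℝ)..t, (wgt α s) ^ 2

/-- On positive reals `ω_s² = s^(-α) exp(s^(1-α) / (1-α))`. -/
lemma wgt_sq {α s : ℝ} (hs : 0 < s) :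
    wgt α s ^ 2 = s ^ (-α) * Real.exp (s ^ (1 - α) / (1 - α)) := by
  rw [wgt, mul_pow, ← Real.rpow_mul_natCast hs.le, ← Real.exp_nat_mul]
  congr 2
  · push_cast
    ring
  · push_cast
    rw [mul_comm 2 (1 - α), ← div_div]
    ring

lemma hasDerivAt_exp_rpow_div {α s : ℝ} (hα1 : α < 1) (hs : 0 < s) :
    HasDerivAt (fun x : ℝ => Real.exp (x ^ (1 - α) / (1 - α))) (wgt α s ^ 2) s := by
  have hne : 1 - α ≠ 0 := by linarith
  have h := ((Real.hasDerivAt_rpow_const (p := 1 - α) (Or.inl hs.ne')).div_const (1 - α)).exp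
  convert h using 1
  rw [wgt_sq hs, mul_div_cancel_left₀ _ hne, mul_comm, show 1 - α - 1 = -α by ring]

lemma Vsq_eq {α t : ℝ} (hα1 : α < 1) (ht : 0 ≤ t) :
    Vsq α t = Real.exp (t ^ (1 - α) / (1 - α)) - 1 := by
  have hpos : 0 < 1 - α := by linarith
  have hcont : ContinuousOn (fun x : ℝ => Real.exp (x ^ (1 - α) / (1 - α))) (Set.Icc 0 t) :=
    (Real.continuous_exp.comp
      ((Real.continuous_rpow_const hpos.le).div_const (1 - α))).continuousOn
  have hderiv : ∀ x ∈ Set.Ioo 0 t,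
      HasDerivAt (fun x : ℝ => Real.exp (x ^ (1 - α) / (1 - α))) (wgt α x ^ 2) x :=
    fun x hx => hasDerivAt_exp_rpow_div hα1 hx.1
  have hint : IntervalIntegrable (fun x => wgt α x ^ 2) volume 0 t :=
    (intervalIntegrable_iff_integrableOn_Ioc_of_le ht).2
      (intervalIntegral.integrableOn_deriv_of_nonneg hcont hderiv fun x _ => sq_nonneg _)
  rw [Vsq, intervalIntegral.integral_eq_sub_of_hasDerivAt_of_le ht hcont hderiv hint]
  simp [Real.zero_rpow hpos.ne']

/-- Property (P2) of the weight: `t^(-α) ω_t⁻² V_t² = 1 + o(t^(α-1))` as `t → ∞`. -/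
theorem weight_P2 (α : ℝ) (hα : 1 / 2 < α) (hα1 : α < 1) :
    Tendsto (fun t : ℝ => t ^ (1 - α) * (t ^ (-α) * ((wgt α t) ^ 2)⁻¹ * Vsq α t - 1))
      atTop (nhds 0) := by
  have hpos : 0 < 1 - α := by linarith
  have hlim : Tendsto (fun x : ℝ => -(x * Real.exp (-(1 - α)⁻¹ * x))) atTop (nhds 0) := by
    simpa using (tendsto_rpow_mul_exp_neg_mul_atTop_nhds_zero 1 _ (inv_pos.2 hpos)).neg
  refine (hlim.comp (tendsto_rpow_atTop hpos)).congr' ?_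
  filter_upwards [eventually_gt_atTop 0] with t ht
  have hne : t ^ (-α) ≠ 0 := (Real.rpow_pos_of_pos ht _).ne'
  have hexp : Real.exp (-(1 - α)⁻¹ * t ^ (1 - α)) = (Real.exp (t ^ (1 - α) / (1 - α)))⁻¹ := by
    rw [← Real.exp_neg]
    ring_nf
  rw [Function.comp_apply, hexp, wgt_sq ht, Vsq_eq hα1 ht.le]
  field_simp
  ring
end
end

section
/- Weighted averaging lemma, L¹-weight version: let c ∈ ℝ, let 1/2 ≤ α' < α, and let f : [0,∞) → ℝ be continuous with (1/t) ∫_0^t f(s) ds = c + o(t^{α'−1}) as t → ∞. Then ( ∫_0^t ω_s f(s) ds ) / U_t = c + o(t^{α'−α}) as t → ∞. -/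
open MeasureTheory ProbabilityTheory Filter Real Asymptotics

noncomputable section

theorem wgt_pos (α : ℝ) {s : ℝ} (hs : 0 < s) : 0 < wgt α s :=
  mul_pos (Real.rpow_pos_of_pos hs _) (Real.exp_pos _)

theorem rpow_le_wgt {α s : ℝ} (hα1 : α < 1) (hs : 0 < s) : s ^ (-α / 2) ≤ wgt α s := by
  refine le_mul_of_one_le_right (Real.rpow_nonneg hs.le _) (Real.one_le_exp ?_)
  have : 0 < 1 - α := by linarith
  positivity

theorem hasDerivAt_wgt {α s : ℝ} (hα1 : α < 1) (hs : 0 < s) :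
    HasDerivAt (wgt α) (wgt' α s) s := by
  have h0 : 1 - α ≠ 0 := by linarith
  have h1 := Real.hasDerivAt_rpow_const (x := s) (p := -α / 2) (Or.inl hs.ne')
  have h2 := ((Real.hasDerivAt_rpow_const (x := s) (p := 1 - α)
    (Or.inl hs.ne')).div_const (2 * (1 - α))).exp
  refine (h1.mul h2).congr_deriv ?_
  have e1 : s ^ (-α / 2 - 1) = s ^ (-α / 2) / s := by rw [Real.rpow_sub_one hs.ne']
  have e2 : (1 - α - 1 : ℝ) = -α := by ring
  rw [wgt', wgt, e1, e2]
  field_simp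
  ring

theorem continuousOn_wgt {α : ℝ} (hα1 : α < 1) : ContinuousOn (wgt α) (Set.Ioi 0) :=
  fun _ hs => (hasDerivAt_wgt hα1 hs).continuousAt.continuousWithinAt

theorem continuousOn_wgt' {α : ℝ} (hα1 : α < 1) : ContinuousOn (wgt' α) (Set.Ioi 0) := by
  refine (continuousOn_wgt hα1).mul (ContinuousOn.sub ?_ ?_)
  · exact (continuousOn_id.rpow_const fun s hs => Or.inl (ne_of_gt hs)).div_const 2
  · exact continuousOn_const.div (by fun_prop) fun s hs => by
      have : 0 < s := hs
      positivity

theorem wgt'_nonneg {α s : ℝ} (hα1 : α < 1) (hs : 1 ≤ s) : 0 ≤ wgt' α s := by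
  have h0 : 0 < s := by linarith
  refine mul_nonneg (wgt_pos α h0).le (sub_nonneg.2 ?_)
  have h1 : 1 ≤ s ^ (1 - α) := Real.one_le_rpow hs (by linarith)
  have h2 : s ^ (-α) = s ^ (1 - α) / s := by
    rw [← Real.rpow_sub_one h0.ne']; ring_nf
  rw [h2, div_div, mul_comm s 2]
  gcongr
  linarith

theorem intervalIntegrable_wgt {α : ℝ} (hα1 : α < 1) (a b : ℝ) :
    IntervalIntegrable (wgt α) volume a b := by
  refine (intervalIntegral.intervalIntegrable_rpow' (by linarith)).mul_continuousOn ?_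
  have : Continuous fun s : ℝ => s ^ (1 - α) := Real.continuous_rpow_const (by linarith)
  fun_prop

theorem tendsto_rpow_mul_wgt {α p : ℝ} (hα1 : α < 1) (hp : α / 2 < p) :
    Tendsto (fun t => t ^ p * wgt α t) atTop atTop := by
  refine tendsto_atTop_mono' _ ?_ (tendsto_rpow_atTop (y := p - α / 2) (by linarith))
  filter_upwards [eventually_gt_atTop 0] with t ht
  calc t ^ (p - α / 2) = t ^ p * t ^ (-α / 2) := by
        rw [← Real.rpow_add ht]; ring_nf
    _ ≤ _ := by gcongr; exact rpow_le_wgt hα1 ht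

/-- The primitive of the weight dominates `t ^ α * ω_t` up to a constant. -/
theorem rpow_mul_wgt_sub_le_Uw {α t : ℝ} (hα1 : α < 1) (ht : 1 ≤ t) :
    t ^ α * wgt α t - wgt α 1 ≤ Uw α t := by
  have hd : ∀ s : ℝ, 0 < s → HasDerivAt (fun s => s ^ α * wgt α s)
      (α * s ^ (α - 1) * wgt α s + s ^ α * wgt' α s) s := fun s hs =>
    (Real.hasDerivAt_rpow_const (Or.inl hs.ne')).mul (hasDerivAt_wgt hα1 hs)
  have hsub : Set.uIcc 1 t ⊆ Set.Ioi (0 : ℝ) := by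
    rw [Set.uIcc_of_le ht]
    exact fun s hs => lt_of_lt_of_le one_pos hs.1
  have hr : ∀ p : ℝ, ContinuousOn (fun s : ℝ => s ^ p) (Set.Ioi 0) := fun p =>
    continuousOn_id.rpow_const fun s hs => Or.inl (ne_of_gt hs)
  have hc : ContinuousOn (fun s => α * s ^ (α - 1) * wgt α s + s ^ α * wgt' α s) (Set.Ioi 0) :=
    ((continuousOn_const.mul (hr _)).mul (continuousOn_wgt hα1)).add
      ((hr _).mul (continuousOn_wgt' hα1))
  have hi := (hc.mono hsub).intervalIntegrable (μ := volume)
  have hftc := intervalIntegral.integral_eq_sub_of_hasDerivAt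
    (fun s hs => hd s (hsub hs)) hi
  have hle := intervalIntegral.integral_mono_on ht hi (intervalIntegrable_wgt hα1 1 t)
    (fun s hs => by
      have hs0 : 0 < s := lt_of_lt_of_le one_pos hs.1
      have e1 : s ^ (α - 1) = s ^ α / s := Real.rpow_sub_one hs0.ne' α
      have e2 : s ^ α * s ^ (-α) = 1 := by rw [← Real.rpow_add hs0]; simp
      have e3 : s ^ (α - 1) ≤ 1 := Real.rpow_le_one_of_one_le_of_nonpos hs.1 (by linarith)
      have e4 : α * s ^ (α - 1) * wgt α s + s ^ α * wgt' α s
          = wgt α s * ((1 + α * s ^ (α - 1)) / 2) := by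
        rw [wgt', e1]
        field_simp
        linear_combination (s * wgt α s) * e2
      rw [e4]
      have hw := wgt_pos α hs0
      refine mul_le_of_le_one_right hw.le ?_
      have : α * s ^ (α - 1) ≤ 1 := mul_le_one₀ hα1.le (by positivity) e3
      linarith)
  have h01 : 0 ≤ ∫ s in (0 : ℝ)..1, wgt α s :=
    intervalIntegral.integral_nonneg zero_le_one fun s hs =>
      mul_nonneg (Real.rpow_nonneg hs.1 _) (Real.exp_pos _).le
  have hadd := intervalIntegral.integral_add_adjacent_intervals
    (intervalIntegrable_wgt hα1 0 1) (intervalIntegrable_wgt hα1 1 t)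
  rw [Uw]
  simp only [Real.one_rpow, one_mul] at hftc
  linarith

theorem eventually_rpow_mul_wgt_le_Uw {α : ℝ} (hα : 0 < α) (hα1 : α < 1) :
    ∀ᶠ t in atTop, t ^ α * wgt α t ≤ 2 * Uw α t := by
  filter_upwards [eventually_ge_atTop 1,
    (tendsto_rpow_mul_wgt hα1 (half_lt_self hα)).eventually_ge_atTop (2 * wgt α 1)] with t ht h
  linarith [rpow_mul_wgt_sub_le_Uw hα1 ht]

/-- If the primitive of `g` is `o(t ^ p)`, then that of `ω g` is `o(t ^ p ω_t)`. -/
theorem isLittleO_integral_wgt_mul {α p : ℝ} (hα : 0 < α) (hα1 : α < 1) (hp : α / 2 < p)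
    {g : ℝ → ℝ} (hg : ContinuousOn g (Set.Ici 0))
    (hG : (fun t => ∫ s in (0 : ℝ)..t, g s) =o[atTop] fun t : ℝ => t ^ p) :
    (fun t => ∫ s in (0 : ℝ)..t, wgt α s * g s) =o[atTop] fun t => t ^ p * wgt α t := by
  have hgi : ∀ a b : ℝ, 0 ≤ a → 0 ≤ b → IntervalIntegrable g volume a b := fun a b ha hb =>
    (hg.mono fun s hs => (le_min ha hb).trans hs.1).intervalIntegrable
  have hwgi : ∀ a b : ℝ, 0 ≤ a → 0 ≤ b →
      IntervalIntegrable (fun s => wgt α s * g s) volume a b := fun a b ha hb =>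
    (intervalIntegrable_wgt hα1 a b).mul_continuousOn
      (hg.mono fun s hs => (le_min ha hb).trans hs.1)
  set G : ℝ → ℝ := fun t => ∫ s in (0 : ℝ)..t, g s with hGdef
  have hGd : ∀ t : ℝ, 0 < t → HasDerivAt G (g t) t := fun t ht =>
    intervalIntegral.integral_hasDerivAt_right (hgi 0 t le_rfl ht.le)
      ((hg.mono Set.Ioi_subset_Ici_self).stronglyMeasurableAtFilter isOpen_Ioi t ht)
      (hg.continuousAt (Ici_mem_nhds ht))
  refine isLittleO_iff.2 fun ε hε => ?_
  have hε3 : 0 < ε / 3 := by positivity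
  obtain ⟨T, hT⟩ := eventually_atTop.1
    ((isLittleO_iff.1 hG hε3).and (eventually_ge_atTop 1))
  have hT1 : 1 ≤ T := (hT T le_rfl).2
  have hT0 : 0 < T := by linarith
  have hbd : ∀ s, T ≤ s → |G s| ≤ ε / 3 * s ^ p := fun s hs => by
    have h := (hT s hs).1
    rwa [Real.norm_eq_abs, Real.norm_eq_abs,
      abs_of_nonneg (Real.rpow_nonneg (hT0.le.trans hs) p)] at h
  set K : ℝ := (∫ s in (0 : ℝ)..T, wgt α s * g s) - wgt α T * G T with hK
  filter_upwards [eventually_ge_atTop T,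
    (tendsto_rpow_mul_wgt hα1 hp).eventually_ge_atTop (|K| / (ε / 3))] with t ht htK
  have ht0 : 0 < t := by linarith
  have hwt := wgt_pos α ht0
  have hsub : Set.uIcc T t ⊆ Set.Ioi (0 : ℝ) := by
    rw [Set.uIcc_of_le ht]
    exact fun s hs => lt_of_lt_of_le hT0 hs.1
  have hw'i := ((continuousOn_wgt' hα1).mono hsub).intervalIntegrable (μ := volume)
  have hparts := intervalIntegral.integral_mul_deriv_eq_deriv_mul
    (fun s hs => hasDerivAt_wgt hα1 (hsub hs)) (fun s hs => hGd s (hsub hs)) hw'i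
    (hgi T t hT0.le ht0.le)
  have hadd := intervalIntegral.integral_add_adjacent_intervals
    (hwgi 0 T le_rfl hT0.le) (hwgi T t hT0.le ht0.le)
  have hftc := intervalIntegral.integral_eq_sub_of_hasDerivAt
    (fun s hs => hasDerivAt_wgt hα1 (hsub hs)) hw'i
  have hrem : |∫ s in T..t, wgt' α s * G s| ≤ ε / 3 * (t ^ p * wgt α t) := by
    have h1 : |∫ s in T..t, wgt' α s * G s| ≤ ∫ s in T..t, wgt' α s * (ε / 3 * t ^ p) := by
      rw [← Real.norm_eq_abs]
      refine intervalIntegral.norm_integral_le_of_norm_le ht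
        (Eventually.of_forall fun s hs => ?_) (hw'i.mul_const _)
      have hw' := wgt'_nonneg hα1 (hT1.trans hs.1.le)
      rw [norm_mul, Real.norm_eq_abs, Real.norm_eq_abs, abs_of_nonneg hw']
      refine mul_le_mul_of_nonneg_left ((hbd s hs.1.le).trans ?_) hw'
      exact mul_le_mul_of_nonneg_left
        (Real.rpow_le_rpow (hT0.le.trans hs.1.le) hs.2 (by linarith)) hε3.le
    rw [intervalIntegral.integral_mul_const, hftc] at h1
    have h2 : 0 ≤ wgt α T * (ε / 3 * t ^ p) := by
      have := wgt_pos α hT0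
      positivity
    linarith
  have hbdry : |wgt α t * G t| ≤ ε / 3 * (t ^ p * wgt α t) := by
    rw [abs_mul, abs_of_pos hwt]
    linarith [mul_le_mul_of_nonneg_left (hbd t ht) hwt.le]
  have hconst : |K| ≤ ε / 3 * (t ^ p * wgt α t) := by
    rw [div_le_iff₀ hε3] at htK
    linarith
  have heq : ∫ s in (0 : ℝ)..t, wgt α s * g s
      = K + wgt α t * G t - ∫ s in T..t, wgt' α s * G s := by
    rw [← hadd, hparts, hK]
    ring
  rw [heq, Real.norm_eq_abs, Real.norm_of_nonneg (by positivity)]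
  linarith [abs_sub (K + wgt α t * G t) (∫ s in T..t, wgt' α s * G s),
    abs_add_le K (wgt α t * G t)]

/-- Weighted averaging lemma, L¹-weight version: if `(1/t) ∫₀ᵗ f = c + o(t^(α'-1))`, then
`(∫₀ᵗ ω_s f(s) ds) / U_t = c + o(t^(α'-α))`. -/
theorem weighted_average (α α' c : ℝ) (hα : 1 / 2 < α) (hα1 : α < 1)
    (hα' : 1 / 2 ≤ α') (hα'α : α' < α)
    (f : ℝ → ℝ) (hf : ContinuousOn f (Set.Ici 0))
    (hmean : Tendsto (fun t : ℝ => t ^ (1 - α') * ((1 / t) * (∫ s in (0:ℝ)..t, f s) - c))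
      atTop (nhds 0)) :
    Tendsto
      (fun t : ℝ => t ^ (α - α') * ((∫ s in (0:ℝ)..t, wgt α s * f s) / Uw α t - c))
      atTop (nhds 0) := by
  have hα0 : 0 < α := by linarith
  have hg : ContinuousOn (fun s => f s - c) (Set.Ici 0) := hf.sub continuousOn_const
  have hfsub : ∀ t : ℝ, 0 < t → Set.uIcc 0 t ⊆ Set.Ici 0 := fun t ht s hs =>
    (le_min le_rfl ht.le).trans hs.1
  have hG : (fun t => ∫ s in (0 : ℝ)..t, (f s - c)) =o[atTop] fun t : ℝ => t ^ α' := by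
    refine (isLittleO_iff_tendsto' ?_).2 (hmean.congr' ?_)
    · filter_upwards [eventually_gt_atTop 0] with t ht h
      exact absurd h (Real.rpow_pos_of_pos ht _).ne'
    · filter_upwards [eventually_gt_atTop 0] with t ht
      rw [intervalIntegral.integral_sub (hf.mono (hfsub t ht)).intervalIntegrable
        intervalIntegrable_const, intervalIntegral.integral_const, Real.rpow_sub ht,
        Real.rpow_one, smul_eq_mul, sub_zero]
      have := Real.rpow_pos_of_pos ht α'
      field_simp
  have hU := eventually_rpow_mul_wgt_le_Uw hα0 hα1
  have hO : (fun t => t ^ α' * wgt α t) =O[atTop] fun t => t ^ (α' - α) * Uw α t := by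
    refine IsBigO.of_bound 2 ?_
    filter_upwards [hU, eventually_gt_atTop 0] with t ht ht0
    have hw := wgt_pos α ht0
    have hU0 : 0 ≤ Uw α t := by
      have : 0 ≤ t ^ α * wgt α t := by positivity
      linarith
    rw [Real.norm_of_nonneg (by positivity), Real.norm_of_nonneg (by positivity)]
    calc t ^ α' * wgt α t = t ^ (α' - α) * (t ^ α * wgt α t) := by
          rw [← mul_assoc, ← Real.rpow_add ht0, sub_add_cancel]
      _ ≤ t ^ (α' - α) * (2 * Uw α t) := by gcongr
      _ = _ := by ring
  have hmain := ((isLittleO_integral_wgt_mul hα0 hα1 (by linarith) hg hG).trans_isBigO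
    hO).tendsto_div_nhds_zero
  refine hmain.congr' ?_
  filter_upwards [hU, eventually_gt_atTop 0] with t ht ht0
  have hw := wgt_pos α ht0
  have hU0 : 0 < Uw α t := by
    have : 0 < t ^ α * wgt α t := by positivity
    linarith
  have hint : ∫ s in (0 : ℝ)..t, wgt α s * (f s - c)
      = (∫ s in (0 : ℝ)..t, wgt α s * f s) - Uw α t * c := by
    simp only [mul_sub]
    rw [intervalIntegral.integral_sub
      ((intervalIntegrable_wgt hα1 0 t).mul_continuousOn (hf.mono (hfsub t ht0)))
      ((intervalIntegrable_wgt hα1 0 t).mul_const c), intervalIntegral.integral_mul_const, Uw]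
  have hr : t ^ (α - α') = (t ^ (α' - α))⁻¹ := by
    rw [← Real.rpow_neg ht0.le, neg_sub]
  have := Real.rpow_pos_of_pos ht0 (α' - α)
  rw [hint, hr]
  field_simp
end
end
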